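/- Assume (A1) and let η > 0. Then for every finite Borel measure ℙ' on (Ω, ℬ) that is absolutely continuous with respect to ℙ, the mapping u ↦ ∫_Ω Φ_η[u ⊙ Υ(ω)] dℙ'(ω) is well-defined and lower semicontinuous on 𝒰_Υ. -/

import Mathlib

open Matrix Set

/-- The lower-level quadratic objective `f ↦ fᵀ M H[u]⁻¹ M f`. -/
noncomputable def lowerObj {n N : ℕ} (M : Matrix (Fin N) (Fin N) ℝ)
    (H : (Fin n → ℝ) → Matrix (Fin N) (Fin N) ℝ)
    (u : Fin n → ℝ) (f : Fin N → ℝ) : ℝ :=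
  f ⬝ᵥ ((M * (H u)⁻¹ * M) *ᵥ f)

/-- The lower-level optimal value function `ψ[u] = max_{f ∈ ℱ} fᵀ M H[u]⁻¹ M f`. -/
noncomputable def psiVal {n N : ℕ} (M : Matrix (Fin N) (Fin N) ℝ)
    (H : (Fin n → ℝ) → Matrix (Fin N) (Fin N) ℝ)
    (F : Set (Fin N → ℝ)) (u : Fin n → ℝ) : ℝ :=
  sSup (lowerObj M H u '' F)

/-- The lower-level solution set mapping `Ψ[u] = {f ∈ ℱ : fᵀ M H[u]⁻¹ M f = ψ[u]}`. -/
noncomputable def PsiSet {n N : ℕ} (M : Matrix (Fin N) (Fin N) ℝ)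
    (H : (Fin n → ℝ) → Matrix (Fin N) (Fin N) ℝ)
    (F : Set (Fin N → ℝ)) (u : Fin n → ℝ) : Set (Fin N → ℝ) :=
  {f ∈ F | lowerObj M H u f = psiVal M H F u}

/-- The pessimistic value function `Φ[u] = max_{f ∈ Ψ[u]} J[u,f]`. -/
noncomputable def PhiVal {n N : ℕ} (M : Matrix (Fin N) (Fin N) ℝ)
    (H : (Fin n → ℝ) → Matrix (Fin N) (Fin N) ℝ)
    (F : Set (Fin N → ℝ)) (J : (Fin n → ℝ) → (Fin N → ℝ) → ℝ)
    (u : Fin n → ℝ) : ℝ :=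
  sSup ((J u) '' PsiSet M H F u)

/-- The set of `η`-optimal lower-level solutions
`Ψ_η[u] = {f ∈ ℱ : ψ[u] - fᵀ M H[u]⁻¹ M f < η}`. -/
noncomputable def PsiEta {n N : ℕ} (M : Matrix (Fin N) (Fin N) ℝ)
    (H : (Fin n → ℝ) → Matrix (Fin N) (Fin N) ℝ)
    (F : Set (Fin N → ℝ)) (η : ℝ) (u : Fin n → ℝ) : Set (Fin N → ℝ) :=
  {f ∈ F | psiVal M H F u - lowerObj M H u f < η}

/-- The regularized pessimistic value function `Φ_η[u] = sup_{f ∈ Ψ_η[u]} J[u,f]`. -/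
noncomputable def PhiEta {n N : ℕ} (M : Matrix (Fin N) (Fin N) ℝ)
    (H : (Fin n → ℝ) → Matrix (Fin N) (Fin N) ℝ)
    (F : Set (Fin N → ℝ)) (J : (Fin n → ℝ) → (Fin N → ℝ) → ℝ)
    (η : ℝ) (u : Fin n → ℝ) : ℝ :=
  sSup ((J u) '' PsiEta M H F η u)

/-- The topological support of a Borel measure: points all of whose open
neighbourhoods have positive measure. -/
def measSupport {α : Type*} [TopologicalSpace α] [MeasurableSpace α]
    (μ : MeasureTheory.Measure α) : Set α :=
  {x | ∀ s : Set α, IsOpen s → x ∈ s → 0 < μ s}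

theorem measSupport_eq_support {α : Type*} [TopologicalSpace α] [MeasurableSpace α]
    (μ : MeasureTheory.Measure α) : measSupport μ = μ.support := by
  ext x
  rw [(nhds_basis_opens x).mem_measureSupport]
  exact ⟨fun h s hs => h s hs.2 hs.1, fun h s ho hx => h s ⟨hx, ho⟩⟩

/-- A real function that is lower semicontinuous on a measurable set `s` coincides on `s` with a
measurable function. -/
theorem LowerSemicontinuousOn.measurable_indicator {X : Type*} [TopologicalSpace X]
    [MeasurableSpace X] [OpensMeasurableSpace X] {φ : X → ℝ} {s : Set X}
    (hφ : LowerSemicontinuousOn φ s) (hs : MeasurableSet s) : Measurable (s.indicator φ) := by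
  refine measurable_of_restrict_of_restrict_compl hs ?_ ?_
  · convert (lowerSemicontinuous_restrict_iff.2 hφ).measurable using 1
    exact funext fun x => Set.indicator_of_mem x.2 φ
  · convert measurable_const (a := (0 : ℝ)) using 1
    exact funext fun x => Set.indicator_of_notMem x.2 φ

section Integral

open MeasureTheory Filter Topology

variable {Ω E X : Type*} [MeasurableSpace Ω] [TopologicalSpace X]
  [MeasurableSpace X] [OpensMeasurableSpace X] {μ : Measure Ω} [IsFiniteMeasure μ]
  {U : Set X} {φ : X → ℝ}

theorem LowerSemicontinuousOn.integrable_comp (hU : MeasurableSet U)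
    (hφ : LowerSemicontinuousOn φ U) {g : Ω → X} (hg : Measurable g)
    (hgU : ∀ᵐ ω ∂μ, g ω ∈ U) {C : ℝ} (hC : ∀ᵐ ω ∂μ, |φ (g ω)| ≤ C) :
    Integrable (fun ω => φ (g ω)) μ := by
  refine Integrable.of_bound (C := C) ?_ hC
  refine (((hφ.measurable_indicator hU).comp hg).aestronglyMeasurable).congr ?_
  filter_upwards [hgU] with ω hω using Set.indicator_of_mem hω φ

/-- Lower semicontinuity passes through the integral under a local uniform bound. -/
theorem LowerSemicontinuousOn.lowerSemicontinuousWithinAt_integral [TopologicalSpace E]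
    [FirstCountableTopology E] (hU : MeasurableSet U) (hφ : LowerSemicontinuousOn φ U)
    {g : E → Ω → X} (hg : ∀ u, Measurable (g u)) (hgc : ∀ ω, Continuous fun u => g u ω)
    {s : Set E} (hgU : ∀ᵐ ω ∂μ, ∀ u ∈ s, g u ω ∈ U) {u₀ : E} (hu₀ : u₀ ∈ s) {C : ℝ}
    (hC : ∀ᶠ u in 𝓝[s] u₀, ∀ᵐ ω ∂μ, |φ (g u ω)| ≤ C) :
    LowerSemicontinuousWithinAt (fun u => ∫ ω, φ (g u ω) ∂μ) s u₀ := by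
  intro y hy
  have hint : ∀ u ∈ s, (∀ᵐ ω ∂μ, |φ (g u ω)| ≤ C) → Integrable (fun ω => φ (g u ω)) μ :=
    fun u hu h => hφ.integrable_comp hU (hg u) (hgU.mono fun ω hω => hω u hu) h
  have hC₀ := hC.self_of_nhdsWithin hu₀
  have hlim : Tendsto (fun u => ∫ ω, min (φ (g u ω)) (φ (g u₀ ω)) ∂μ) (𝓝[s] u₀)
      (𝓝 (∫ ω, φ (g u₀ ω) ∂μ)) := by
    refine tendsto_integral_filter_of_dominated_convergence (fun _ => C) ?_ ?_
      (integrable_const C) ?_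
    · filter_upwards [hC, self_mem_nhdsWithin] with u hu hus
      exact ((hint u hus hu).inf (hint u₀ hu₀ hC₀)).aestronglyMeasurable
    · filter_upwards [hC] with u hu
      filter_upwards [hu, hC₀] with ω h h₀
      exact abs_min_le_max_abs_abs.trans (max_le h h₀)
    · filter_upwards [hgU] with ω hω
      have hcont : Tendsto (fun u => g u ω) (𝓝[s] u₀) (𝓝[U] (g u₀ ω)) :=
        tendsto_nhdsWithin_iff.2 ⟨(hgc ω).continuousWithinAt,
          eventually_nhdsWithin_of_forall fun u hu => hω u hu⟩
      refine tendsto_order.2 ⟨fun a ha => ?_, fun a ha =>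
        Eventually.of_forall fun u => (min_le_right _ _).trans_lt ha⟩
      filter_upwards [hcont.eventually (hφ _ (hω u₀ hu₀) a ha)] with u hu
      exact lt_min hu ha
  filter_upwards [hlim.eventually_const_lt hy, hC, self_mem_nhdsWithin] with u hu huC hus
  exact hu.trans_le (integral_mono ((hint u hus huC).inf (hint u₀ hu₀ hC₀)) (hint u hus huC)
    fun ω => min_le_left _ _)

end Integral

section ValueFunction

open Topology Filter

variable {n N : ℕ} {M : Matrix (Fin N) (Fin N) ℝ}
  {H : (Fin n → ℝ) → Matrix (Fin N) (Fin N) ℝ} {U : Set (Fin n → ℝ)} {F : Set (Fin N → ℝ)}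
  {J : (Fin n → ℝ) → (Fin N → ℝ) → ℝ} {η : ℝ}

theorem continuous_lowerObj_restrict (hHcont : ContinuousOn H U)
    (hHpd : ∀ u ∈ U, (H u).PosDef) :
    Continuous fun p : U × (Fin N → ℝ) => lowerObj M H p.1 p.2 := by
  have hinv : Continuous fun u : U => (H u)⁻¹ := by
    refine continuous_iff_continuousAt.2 fun u => ?_
    have hH : ContinuousAt (fun u : U => H u) u :=
      (continuousOn_iff_continuous_domRestrict.1 hHcont).continuousAt
    refine ContinuousAt.comp (f := fun u : U => H u) (continuousAt_matrix_inv _ ?_) hH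
    rw [Ring.inverse_eq_inv']
    exact continuousAt_inv₀ (hHpd u u.2).det_pos.ne'
  unfold lowerObj
  have := hinv.comp (continuous_fst (X := U) (Y := Fin N → ℝ))
  exact continuous_snd.dotProduct
    (((continuous_const.mul this).mul continuous_const).matrix_mulVec continuous_snd)

theorem continuousOn_lowerObj (hHcont : ContinuousOn H U) (hHpd : ∀ u ∈ U, (H u).PosDef)
    (f : Fin N → ℝ) : ContinuousOn (fun u => lowerObj M H u f) U :=
  continuousOn_iff_continuous_domRestrict.2
    ((continuous_lowerObj_restrict hHcont hHpd).comp (Continuous.prodMk_left f))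

theorem continuousOn_psiVal (hFcomp : IsCompact F) (hHcont : ContinuousOn H U)
    (hHpd : ∀ u ∈ U, (H u).PosDef) : ContinuousOn (psiVal M H F) U :=
  continuousOn_iff_continuous_domRestrict.2
    (hFcomp.continuous_sSup (f := fun (u : U) f => lowerObj M H u f)
      (continuous_lowerObj_restrict hHcont hHpd))

theorem PsiEta_nonempty (hFne : F.Nonempty) (hη : 0 < η) (u : Fin n → ℝ) :
    (PsiEta M H F η u).Nonempty := by
  obtain ⟨_, ⟨f, hf, rfl⟩, hlt⟩ :=
    exists_lt_of_lt_csSup (hFne.image (lowerObj M H u)) (sub_lt_self (psiVal M H F u) hη)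
  exact ⟨f, hf, by linarith⟩

theorem bddAbove_image_PsiEta (hFcomp : IsCompact F)
    (hJ : ContinuousOn (fun p : (Fin n → ℝ) × (Fin N → ℝ) => J p.1 p.2) (U ×ˢ univ))
    {u : Fin n → ℝ} (hu : u ∈ U) : BddAbove (J u '' PsiEta M H F η u) := by
  have hJu : ContinuousOn (J u) F :=
    hJ.comp (Continuous.prodMk_right u).continuousOn fun f _ => ⟨hu, mem_univ f⟩
  exact (hFcomp.bddAbove_image hJu).mono (image_mono (sep_subset _ _))

theorem lowerSemicontinuousOn_PhiEta (hFne : F.Nonempty) (hFcomp : IsCompact F)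
    (hHcont : ContinuousOn H U) (hHpd : ∀ u ∈ U, (H u).PosDef)
    (hJ : ContinuousOn (fun p : (Fin n → ℝ) × (Fin N → ℝ) => J p.1 p.2) (U ×ˢ univ))
    (hη : 0 < η) : LowerSemicontinuousOn (PhiEta M H F J η) U := by
  intro u₀ hu₀ y hy
  obtain ⟨_, ⟨f, ⟨hfF, hf⟩, rfl⟩, hyf⟩ :=
    exists_lt_of_lt_csSup ((PsiEta_nonempty hFne hη u₀).image (J u₀)) hy
  have hgap : ContinuousWithinAt (fun u => psiVal M H F u - lowerObj M H u f) U u₀ :=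
    ((continuousOn_psiVal hFcomp hHcont hHpd).sub (continuousOn_lowerObj hHcont hHpd f)) u₀ hu₀
  have hJf : ContinuousOn (fun u => J u f) U :=
    hJ.comp (Continuous.prodMk_left f).continuousOn fun u hu => ⟨hu, mem_univ f⟩
  filter_upwards [hgap.eventually_lt_const hf, (hJf u₀ hu₀).eventually_const_lt hyf,
    self_mem_nhdsWithin] with u hu hyu huU
  exact hyu.trans_le (le_csSup (bddAbove_image_PsiEta hFcomp hJ huU) ⟨f, ⟨hfF, hu⟩, rfl⟩)

theorem exists_abs_PhiEta_le (hFne : F.Nonempty) (hFcomp : IsCompact F)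
    (hJ : ContinuousOn (fun p : (Fin n → ℝ) × (Fin N → ℝ) => J p.1 p.2) (U ×ˢ univ))
    (hη : 0 < η) {K : Set (Fin n → ℝ)} (hK : IsCompact K) (hKU : K ⊆ U) :
    ∃ C, ∀ u ∈ K, |PhiEta M H F J η u| ≤ C := by
  obtain ⟨C, hC⟩ := (hK.prod hFcomp).exists_bound_of_continuousOn
    (hJ.mono (prod_mono hKU (subset_univ F)))
  refine ⟨C, fun u hu => ?_⟩
  have hJC : ∀ f ∈ F, |J u f| ≤ C := fun f hf => hC (u, f) ⟨hu, hf⟩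
  obtain ⟨f, hf⟩ := PsiEta_nonempty (M := M) (H := H) hFne hη u
  refine abs_le.2 ⟨(abs_le.1 (hJC f hf.1)).1.trans
    (le_csSup (bddAbove_image_PsiEta hFcomp hJ (hKU hu)) ⟨f, hf, rfl⟩),
    csSup_le ⟨_, f, hf, rfl⟩ ?_⟩
  rintro _ ⟨g, hg, rfl⟩
  exact (abs_le.1 (hJC g hg.1)).2

end ValueFunction

open MeasureTheory Filter ENNReal in
theorem stmt17 (n N : ℕ) (hn : 0 < n) (hN : 0 < N)
    (U : Set (Fin n → ℝ)) (hUpos : ∀ u ∈ U, ∀ i, 0 < u i)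
    (hUne : U.Nonempty) (hUcl : IsClosed U)
    (M : Matrix (Fin N) (Fin N) ℝ) (hM : M.PosDef)
    (F : Set (Fin N → ℝ)) (hFne : F.Nonempty) (hFconv : Convex ℝ F)
    (hFcomp : IsCompact F)
    (H : (Fin n → ℝ) → Matrix (Fin N) (Fin N) ℝ)
    (hHcont : ContinuousOn H U) (hHpd : ∀ u ∈ U, (H u).PosDef)
    (J : (Fin n → ℝ) → (Fin N → ℝ) → ℝ)
    (hJ : ContinuousOn (fun p : (Fin n → ℝ) × (Fin N → ℝ) => J p.1 p.2)
      (U ×ˢ Set.univ))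
    (η : ℝ) (hη : 0 < η)
    -- the underlying probability space and the random perturbation Υ
    {Ω : Type*} [MeasurableSpace Ω] (Pr : Measure Ω) [IsProbabilityMeasure Pr]
    (Υ : Ω → (Fin n → ℝ)) (hΥ : Measurable Υ)
    (hsuppne : (measSupport (Pr.map Υ)).Nonempty)
    -- (A1): the support of μ_Υ is bounded
    (hA1 : Bornology.IsBounded (measSupport (Pr.map Υ)))
    -- ℙ', a finite Borel measure absolutely continuous w.r.t. ℙ
    (Pr' : Measure Ω) [IsFiniteMeasure Pr'] (hac : Pr' ≪ Pr) :
    -- u ↦ ∫_Ω Φ_η[u ⊙ Υ(ω)] dℙ'(ω) is well-defined on 𝒰_Υ ...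
    (∀ u ∈ {u : Fin n → ℝ | ∀ υ ∈ measSupport (Pr.map Υ), u * υ ∈ U},
      Integrable (fun ω => PhiEta M H F J η (u * Υ ω)) Pr') ∧
    -- ... and lower semicontinuous on 𝒰_Υ
    LowerSemicontinuousOn
      (fun u => ∫ ω, PhiEta M H F J η (u * Υ ω) ∂Pr')
      {u : Fin n → ℝ | ∀ υ ∈ measSupport (Pr.map Υ), u * υ ∈ U} := by
  set S := measSupport (Pr.map Υ) with hS
  set V := {u : Fin n → ℝ | ∀ υ ∈ S, u * υ ∈ U} with hV
  have hScomp : IsCompact S := Metric.isCompact_of_isClosed_isBounded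
    (by rw [hS, measSupport_eq_support]; exact Measure.isClosed_support) hA1
  have hVcl : IsClosed V := by
    have : V = ⋂ υ ∈ S, (fun u : Fin n → ℝ => u * υ) ⁻¹' U := by ext; simp [hV]
    rw [this]
    exact isClosed_biInter fun υ _ => hUcl.preimage (continuous_mul_const υ)
  have hΥS : ∀ᵐ ω ∂Pr', Υ ω ∈ S := by
    refine hac.ae_le (ae_of_ae_map hΥ.aemeasurable ?_)
    rw [hS, measSupport_eq_support]
    exact Measure.support_mem_ae
  have hgU : ∀ᵐ ω ∂Pr', ∀ u ∈ V, u * Υ ω ∈ U := hΥS.mono fun ω hω u hu => hu _ hω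
  have hlsc := lowerSemicontinuousOn_PhiEta (M := M) hFne hFcomp hHcont hHpd hJ hη
  have hbound : ∀ K : Set (Fin n → ℝ), IsCompact K → K ⊆ V →
      ∃ C, ∀ u ∈ K, ∀ᵐ ω ∂Pr', |PhiEta M H F J η (u * Υ ω)| ≤ C := by
    intro K hK hKV
    obtain ⟨C, hC⟩ := exists_abs_PhiEta_le (M := M) (H := H) hFne hFcomp hJ hη
      ((hK.prod hScomp).image continuous_mul)
      (by rintro _ ⟨⟨u, υ⟩, ⟨hu, hυ⟩, rfl⟩; exact hKV hu υ hυ)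
    exact ⟨C, fun u hu => hΥS.mono fun ω hω => hC _ ⟨(u, Υ ω), ⟨hu, hω⟩, rfl⟩⟩
  have hmeas : ∀ u : Fin n → ℝ, Measurable fun ω => u * Υ ω := fun u => hΥ.const_mul u
  refine ⟨fun u hu => ?_, fun u₀ hu₀ => ?_⟩
  · obtain ⟨C, hC⟩ := hbound {u} isCompact_singleton (singleton_subset_iff.2 hu)
    exact hlsc.integrable_comp hUcl.measurableSet (hmeas u) (hgU.mono fun ω hω => hω u hu)
      (hC u rfl)
  · obtain ⟨C, hC⟩ := hbound (Metric.closedBall u₀ 1 ∩ V)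
      ((isCompact_closedBall u₀ 1).inter_right hVcl) inter_subset_right
    refine hlsc.lowerSemicontinuousWithinAt_integral hUcl.measurableSet
      (g := fun u ω => u * Υ ω) hmeas
      (fun ω => continuous_mul_const (Υ ω)) hgU hu₀ (C := C) ?_
    filter_upwards [self_mem_nhdsWithin,
      mem_nhdsWithin_of_mem_nhds (Metric.closedBall_mem_nhds u₀ one_pos)] with u huV hub
    exact hC u ⟨hub, huV⟩
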